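/- Let (X,d_X) and (Y,d_Y) be bounded metric spaces, each with at least two points, and let k > 0. Suppose T : LPM_k(X,d_X) → LPM_k(Y,d_Y) is a bijective sup-metric isometry satisfying T(Pp(X) ∩ LPM_k(X,d_X)) = Pp(Y) ∩ LPM_k(Y,d_Y). Then there exists a surjective isometry ϕ : Y → X (d_X(ϕ(x),ϕ(y)) = d_Y(x,y) for all x,y) such that T(d)(x,y) = d(ϕ(x), ϕ(y)) for every d ∈ LPM_k(X,d_X) and all x,y ∈ Y; in particular X and Y are isometric. If moreover neither X nor Y has exactly two points, then ϕ is unique. -/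

import Mathlib

open Set Filter

namespace BanachStone

/-- `d` is a pseudometric. -/
def IsPseudometric {Z : Type*} (d : Z → Z → ℝ) : Prop :=
  (∀ z, d z z = 0) ∧ (∀ z w, d z w = d w z) ∧ (∀ z w v, d z v ≤ d z w + d w v)

/-- `d` is bounded. -/
def IsBoundedPM {Z : Type*} (d : Z → Z → ℝ) : Prop := ∃ C : ℝ, ∀ z w, d z w ≤ C

/-- The sup-norm of `d`. -/
noncomputable def supNorm {Z : Type*} (d : Z → Z → ℝ) : ℝ := ⨆ p : Z × Z, d p.1 p.2

/-- The sup-metric between `d` and `ρ`. -/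
noncomputable def supDist {Z : Type*} (d ρ : Z → Z → ℝ) : ℝ :=
  ⨆ p : Z × Z, |d p.1 p.2 - ρ p.1 p.2|

/-- `PM Z`: bounded continuous pseudometrics on `Z`. -/
def PM (Z : Type*) [TopologicalSpace Z] : Set (Z → Z → ℝ) :=
  {d | IsPseudometric d ∧ IsBoundedPM d ∧ Continuous fun p : Z × Z => d p.1 p.2}

/-- The topology induced by `d` (generated by open `d`-balls). -/
def metricTopology {Z : Type*} (d : Z → Z → ℝ) : TopologicalSpace Z :=
  TopologicalSpace.generateFrom {s | ∃ z : Z, ∃ r : ℝ, s = {w | d z w < r}}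

/-- `AM Z`: admissible metrics, i.e. bounded metrics inducing the topology of `Z`. -/
def AM (Z : Type*) [t : TopologicalSpace Z] : Set (Z → Z → ℝ) :=
  {d | IsPseudometric d ∧ IsBoundedPM d ∧ (∀ z w : Z, z ≠ w → 0 < d z w) ∧
    metricTopology d = t}

/-- `Pp Z`: elements of `PM Z` attaining the sup-norm at exactly one unordered pair
of distinct points. -/
def Pp (Z : Type*) [TopologicalSpace Z] : Set (Z → Z → ℝ) :=
  {d | d ∈ PM Z ∧ ∃ z w : Z, z ≠ w ∧ d z w = supNorm d ∧
    ∀ z' w' : Z, z' ≠ w' → d z' w' = supNorm d → ({z', w'} : Set Z) = {z, w}}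

/-- `UPM Z`: bounded pseudometrics uniformly continuous w.r.t. the uniformity of `Z`. -/
def UPM (Z : Type*) [UniformSpace Z] : Set (Z → Z → ℝ) :=
  {d | IsPseudometric d ∧ IsBoundedPM d ∧
    ∀ ε : ℝ, 0 < ε → ∃ U ∈ uniformity Z, ∀ x y : Z, (x, y) ∈ U → d x y < ε}

/-- `UC Z`: bounded uniformly continuous real-valued functions on `Z`. -/
def UC (Z : Type*) [UniformSpace Z] : Set (Z → ℝ) :=
  {f | (∃ C : ℝ, ∀ z, |f z| ≤ C) ∧ UniformContinuous f}

/-- The space `U(Z)`. -/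
def Ucal (Z : Type*) [UniformSpace Z] : Set (Z → Z → ℝ) :=
  {d | d ∈ PM Z ∧ ∀ ε : ℝ, 0 < ε → ∃ F : Finset (Z → ℝ), F.Nonempty ∧
    (↑F : Set (Z → ℝ)) ⊆ UC Z ∧ ∃ δ : ℝ, 0 < δ ∧
    ∀ x y : Z, (∀ f ∈ F, |f x - f y| < δ) → d x y < ε}

/-- The uniformity filter of the coarsest uniformity on `Z` making every bounded
uniformly continuous real-valued function on `Z` uniformly continuous. -/
noncomputable def U0 (Z : Type*) [UniformSpace Z] : Filter (Z × Z) :=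
  ⨅ f ∈ UC Z, Filter.comap (fun p : Z × Z => (f p.1, f p.2)) (uniformity ℝ)

/-- The Lipschitz constant of a pseudometric on a metric space. -/
noncomputable def lip {Z : Type*} [PseudoMetricSpace Z] (d : Z → Z → ℝ) : ENNReal :=
  ⨆ (x : Z) (y : Z) (_ : x ≠ y), ENNReal.ofReal (d x y / dist x y)

/-- `LPM Z`: bounded Lipschitz continuous pseudometrics on `Z`. -/
def LPM (Z : Type*) [MetricSpace Z] : Set (Z → Z → ℝ) :=
  {d | IsPseudometric d ∧ IsBoundedPM d ∧ lip d < ⊤}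

/-- `LPM_k Z`: elements of `LPM Z` with Lipschitz constant `< k`. -/
def LPMlt (k : ℝ) (Z : Type*) [MetricSpace Z] : Set (Z → Z → ℝ) :=
  {d | d ∈ LPM Z ∧ lip d < ENNReal.ofReal k}

/-- `\overline{LPM}_k Z`: elements of `LPM Z` with Lipschitz constant `≤ k`. -/
def LPMle (k : ℝ) (Z : Type*) [MetricSpace Z] : Set (Z → Z → ℝ) :=
  {d | d ∈ LPM Z ∧ lip d ≤ ENNReal.ofReal k}

/-- `Z` has exactly two points. -/
def ExactlyTwo (Z : Type*) : Prop := ∃ a b : Z, a ≠ b ∧ ∀ c : Z, c = a ∨ c = b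

/-- The two-element subsets of `Z`. -/
def Dset (Z : Type*) : Set (Set Z) := {s | ∃ a b : Z, a ≠ b ∧ s = {a, b}}

section Peaks

variable {Z : Type*}

/-- The pseudometric `d` attains its supremum at `(x, y)`. -/
def IsPeak (d : Z → Z → ℝ) (x y : Z) : Prop := ∀ u v, d u v ≤ d x y

/-- The pseudometric `d` attains its supremum at `{x, y}` and at no other pair of distinct
points. -/
def IsStrictPeak (d : Z → Z → ℝ) (x y : Z) : Prop :=
  x ≠ y ∧ IsPeak d x y ∧
    ∀ u v, u ≠ v → IsPeak d u v → (u = x ∧ v = y) ∨ (u = y ∧ v = x)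

theorem IsPseudometric.nonneg {d : Z → Z → ℝ} (hd : IsPseudometric d) (x y : Z) :
    0 ≤ d x y := by
  have h := hd.2.2 x y x
  rw [hd.1, hd.2.1 y x] at h
  linarith

theorem IsPeak.swap {d : Z → Z → ℝ} (hd : IsPseudometric d) {x y : Z} (h : IsPeak d x y) :
    IsPeak d y x := fun u v => (h u v).trans (hd.2.1 x y).le

theorem le_supNorm {d : Z → Z → ℝ} (hd : IsBoundedPM d) (x y : Z) : d x y ≤ supNorm d := by
  obtain ⟨C, hC⟩ := hd
  exact le_ciSup (f := fun p : Z × Z => d p.1 p.2)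
    ⟨C, by rintro _ ⟨p, rfl⟩; exact hC _ _⟩ (x, y)

theorem supNorm_le [Nonempty Z] {d : Z → Z → ℝ} {c : ℝ} (h : ∀ x y, d x y ≤ c) :
    supNorm d ≤ c :=
  ciSup_le fun p => h p.1 p.2

theorem eq_supNorm_iff [Nonempty Z] {d : Z → Z → ℝ} (hd : IsBoundedPM d) {x y : Z} :
    d x y = supNorm d ↔ IsPeak d x y :=
  ⟨fun h u v => h ▸ le_supNorm hd u v,
    fun h => le_antisymm (le_supNorm hd x y) (supNorm_le h)⟩

theorem supDist_le_iff [Nonempty Z] {d e : Z → Z → ℝ} (hd : IsPseudometric d)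
    (he : IsPseudometric e) (hdb : IsBoundedPM d) (heb : IsBoundedPM e) {c : ℝ} :
    supDist d e ≤ c ↔ ∀ x y, |d x y - e x y| ≤ c := by
  obtain ⟨C, hC⟩ := hdb
  obtain ⟨E, hE⟩ := heb
  have hb : BddAbove (range fun p : Z × Z => |d p.1 p.2 - e p.1 p.2|) := by
    refine ⟨C + E, ?_⟩
    rintro _ ⟨p, rfl⟩
    have := hC p.1 p.2
    have := hE p.1 p.2
    have := hd.nonneg p.1 p.2
    have := he.nonneg p.1 p.2
    exact abs_le.2 ⟨by linarith, by linarith⟩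
  exact ⟨fun h x y => (le_ciSup hb (x, y)).trans h, fun h => ciSup_le fun p => h p.1 p.2⟩

end Peaks

section Constructions

variable {Z : Type*}

theorem isPseudometric_abs_sub (f : Z → ℝ) : IsPseudometric fun u v => |f u - f v| :=
  ⟨fun z => by simp, fun z w => abs_sub_comm _ _, fun z w v => abs_sub_le _ _ _⟩

theorem IsPseudometric.smul {d : Z → Z → ℝ} (hd : IsPseudometric d) {s : ℝ} (hs : 0 ≤ s) :
    IsPseudometric fun u v => s * d u v := by
  refine ⟨fun z => by simp [hd.1], fun z w => by simp only [hd.2.1 z w], fun z w v => ?_⟩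
  nlinarith [hd.2.2 z w v]

theorem IsPseudometric.add {d e : Z → Z → ℝ} (hd : IsPseudometric d) (he : IsPseudometric e) :
    IsPseudometric fun u v => d u v + e u v := by
  refine ⟨fun z => by simp [hd.1, he.1], fun z w => by simp only [hd.2.1 z w, he.2.1 z w],
    fun z w v => ?_⟩
  linarith [hd.2.2 z w v, he.2.2 z w v]

theorem IsPseudometric.min_const {d : Z → Z → ℝ} (hd : IsPseudometric d) {c : ℝ} (hc : 0 ≤ c) :
    IsPseudometric fun u v => min (d u v) c := by
  refine ⟨fun z => by simp [hd.1, hc], fun z w => by simp only [hd.2.1 z w], fun z w v => ?_⟩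
  have := hd.2.2 z w v
  have := hd.nonneg z w
  have := hd.nonneg w v
  simp only [min_def]
  split_ifs <;> linarith

theorem IsPseudometric.max {d e : Z → Z → ℝ} (hd : IsPseudometric d) (he : IsPseudometric e) :
    IsPseudometric fun u v => max (d u v) (e u v) := by
  refine ⟨fun z => by simp [hd.1, he.1], fun z w => by simp only [hd.2.1 z w, he.2.1 z w],
    fun z w v => max_le ?_ ?_⟩
  · exact (hd.2.2 z w v).trans (add_le_add (le_max_left _ _) (le_max_left _ _))
  · exact (he.2.2 z w v).trans (add_le_add (le_max_right _ _) (le_max_right _ _))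

/-- The pseudometric obtained from `d` by joining `x` and `y` by an edge of length `c`. -/
def shortcut (d : Z → Z → ℝ) (x y : Z) (c : ℝ) (u v : Z) : ℝ :=
  min (d u v) (min (d u x + c + d y v) (d u y + c + d x v))

theorem IsPseudometric.shortcut {d : Z → Z → ℝ} (hd : IsPseudometric d) (x y : Z) {c : ℝ}
    (hc : 0 ≤ c) : IsPseudometric (shortcut d x y c) := by
  refine ⟨fun z => ?_, fun z w => ?_, fun z w v => ?_⟩
  · have := hd.nonneg z x
    have := hd.nonneg y z
    have := hd.nonneg z y
    have := hd.nonneg x z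
    unfold BanachStone.shortcut
    rw [hd.1, min_eq_left]
    exact le_min (by linarith) (by linarith)
  · unfold BanachStone.shortcut
    rw [hd.2.1 z w, hd.2.1 z x, hd.2.1 y w, hd.2.1 z y, hd.2.1 x w,
      min_comm (d x z + c + d w y)]
    congr 2 <;> ring
  · have h1 := hd.2.2 z w v
    have h2 := hd.2.2 z w x
    have h3 := hd.2.2 z w y
    have h4 := hd.2.2 x w v
    have h5 := hd.2.2 y w v
    have h6 := hd.2.2 z x v
    have h7 := hd.2.2 z y v
    have h8 := hd.nonneg w x
    have h9 := hd.nonneg w y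
    have h10 := hd.2.1 w x
    have h11 := hd.2.1 w y
    have g1 : BanachStone.shortcut d x y c z v ≤ d z v := min_le_left _ _
    have g2 : BanachStone.shortcut d x y c z v ≤ d z x + c + d y v :=
      (min_le_right _ _).trans (min_le_left _ _)
    have g3 : BanachStone.shortcut d x y c z v ≤ d z y + c + d x v :=
      (min_le_right _ _).trans (min_le_right _ _)
    generalize BanachStone.shortcut d x y c z v = t at *
    unfold BanachStone.shortcut
    rcases min_choice (d z w) (min (d z x + c + d y w) (d z y + c + d x w)) with h | h <;>
    rcases min_choice (d w v) (min (d w x + c + d y v) (d w y + c + d x v)) with h' | h' <;>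
    rcases min_choice (d z x + c + d y w) (d z y + c + d x w) with h'' | h'' <;>
    rcases min_choice (d w x + c + d y v) (d w y + c + d x v) with h''' | h''' <;>
    rw [h, h'] <;> (try rw [h'']) <;> (try rw [h''']) <;> linarith

variable [MetricSpace Z] {k : ℝ}

theorem mem_LPMlt {d : Z → Z → ℝ} (hZ : ∃ C : ℝ, ∀ a b : Z, dist a b ≤ C)
    (hd : IsPseudometric d) {c : ℝ} (hc : 0 ≤ c) (hck : c < k)
    (h : ∀ u v, d u v ≤ c * dist u v) : d ∈ LPMlt k Z := by
  have hl : lip d ≤ ENNReal.ofReal c := by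
    refine iSup_le fun u => iSup_le fun v => iSup_le fun huv => ENNReal.ofReal_le_ofReal ?_
    exact (div_le_iff₀ (dist_pos.2 huv)).2 (h u v)
  obtain ⟨C, hC⟩ := hZ
  refine ⟨⟨hd, ⟨c * C, fun u v => (h u v).trans ?_⟩, hl.trans_lt ENNReal.ofReal_lt_top⟩,
    hl.trans_lt ?_⟩
  · exact mul_le_mul_of_nonneg_left (hC u v) hc
  · exact (ENNReal.ofReal_lt_ofReal_iff (hc.trans_lt hck)).2 hck

theorem exists_lipschitz_of_mem_LPMlt {d : Z → Z → ℝ} (hd : d ∈ LPMlt k Z) :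
    ∃ c, 0 ≤ c ∧ c < k ∧ ∀ u v, d u v ≤ c * dist u v := by
  refine ⟨(lip d).toReal, ENNReal.toReal_nonneg, ?_, fun u v => ?_⟩
  · exact (ENNReal.lt_ofReal_iff_toReal_lt hd.1.2.2.ne).1 hd.2
  · by_cases huv : u = v
    · subst huv
      simp [hd.1.1.1]
    · rw [← div_le_iff₀ (dist_pos.2 huv)]
      refine (ENNReal.ofReal_le_iff_le_toReal hd.1.2.2.ne).1 ?_
      exact le_iSup_of_le u (le_iSup_of_le v (le_iSup_of_le huv le_rfl))

theorem lt_of_mem_LPMlt {d : Z → Z → ℝ} (hd : d ∈ LPMlt k Z) {u v : Z}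
    (huv : u ≠ v) : d u v < k * dist u v := by
  obtain ⟨c, -, hck, h⟩ := exists_lipschitz_of_mem_LPMlt hd
  exact (h u v).trans_lt (mul_lt_mul_of_pos_right hck (dist_pos.2 huv))

theorem mem_LPMlt_of_le {d e : Z → Z → ℝ} (hZ : ∃ C : ℝ, ∀ a b : Z, dist a b ≤ C)
    (hd : d ∈ LPMlt k Z) (he : IsPseudometric e)
    (h : ∀ u v, e u v ≤ d u v) : e ∈ LPMlt k Z := by
  obtain ⟨c, hc, hck, hdc⟩ := exists_lipschitz_of_mem_LPMlt hd
  exact mem_LPMlt hZ he hc hck fun u v => (h u v).trans (hdc u v)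

theorem smul_mem_LPMlt {d : Z → Z → ℝ} (hZ : ∃ C : ℝ, ∀ a b : Z, dist a b ≤ C)
    (hd : d ∈ LPMlt k Z) {s : ℝ} (hs : 0 ≤ s)
    (hs1 : s ≤ 1) : (fun u v => s * d u v) ∈ LPMlt k Z :=
  mem_LPMlt_of_le hZ hd (hd.1.1.smul hs)
    fun u v => mul_le_of_le_one_left (hd.1.1.nonneg u v) hs1

theorem continuous_of_mem_LPMlt {d : Z → Z → ℝ} (hd : d ∈ LPMlt k Z) :
    Continuous fun p : Z × Z => d p.1 p.2 := by
  obtain ⟨c, hc, -, h⟩ := exists_lipschitz_of_mem_LPMlt hd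
  have key : ∀ p q : Z × Z, d p.1 p.2 - d q.1 q.2 ≤ 2 * c * dist p q := by
    intro p q
    have h1 := hd.1.1.2.2 p.1 q.1 p.2
    have h2 := hd.1.1.2.2 q.1 q.2 p.2
    have h3 := h p.1 q.1
    have h4 := h q.2 p.2
    have h5 : dist p.1 q.1 ≤ dist p q := le_max_left _ _
    have h6 : dist q.2 p.2 ≤ dist p q := by rw [dist_comm]; exact le_max_right _ _
    nlinarith [mul_le_mul_of_nonneg_left h5 hc, mul_le_mul_of_nonneg_left h6 hc]
  refine (LipschitzWith.of_dist_le_mul (K := ⟨2 * c, by linarith⟩) fun p q => ?_).continuous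
  have h1 := key p q
  have h2 := key q p
  rw [dist_comm] at h2
  change |d p.1 p.2 - d q.1 q.2| ≤ 2 * c * dist p q
  exact abs_le.2 ⟨by linarith, h1⟩

theorem mem_Pp_iff [Nonempty Z] {d : Z → Z → ℝ} (hd : d ∈ LPMlt k Z) :
    d ∈ Pp Z ↔ ∃ x y, IsStrictPeak d x y := by
  have hb := hd.1.2.1
  constructor
  · rintro ⟨-, x, y, hxy, hp, hu⟩
    refine ⟨x, y, hxy, (eq_supNorm_iff hb).1 hp, fun u v huv h => ?_⟩
    exact Set.pair_eq_pair_iff.1 (hu u v huv ((eq_supNorm_iff hb).2 h))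
  · rintro ⟨x, y, hxy, hp, hu⟩
    refine ⟨⟨hd.1.1, hb, continuous_of_mem_LPMlt hd⟩, x, y, hxy,
      (eq_supNorm_iff hb).2 hp, fun u v huv h => ?_⟩
    exact Set.pair_eq_pair_iff.2 (hu u v huv ((eq_supNorm_iff hb).1 h))

theorem exists_isStrictPeak (hk : 0 < k) (hZ : ∃ C : ℝ, ∀ a b : Z, dist a b ≤ C) {x y : Z}
    (hxy : x ≠ y) : ∃ g ∈ LPMlt k Z, IsStrictPeak g x y := by
  have hD := dist_pos.2 hxy
  set D := dist x y with hDdef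
  let f : Z → ℝ := fun u => max 0 (D / 2 - dist x u) - max 0 (D / 2 - dist y u)
  have hfx : f x = D / 2 := by
    simp only [f, dist_self, dist_comm y x, ← hDdef]
    rw [max_eq_right (by linarith), max_eq_left (by linarith)]
    ring
  have hfy : f y = -(D / 2) := by
    simp only [f, dist_self, ← hDdef]
    rw [max_eq_left (by linarith), max_eq_right (by linarith)]
    ring
  have hle : ∀ u, f u ≤ D / 2 := fun u => by
    have : max 0 (D / 2 - dist x u) ≤ D / 2 :=
      max_le (by linarith) (by linarith [dist_nonneg (x := x) (y := u)])
    have := le_max_left 0 (D / 2 - dist y u)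
    simp only [f]
    linarith
  have hge : ∀ u, -(D / 2) ≤ f u := fun u => by
    have : max 0 (D / 2 - dist y u) ≤ D / 2 :=
      max_le (by linarith) (by linarith [dist_nonneg (x := y) (y := u)])
    have := le_max_left 0 (D / 2 - dist x u)
    simp only [f]
    linarith
  have heqx : ∀ u, D / 2 ≤ f u → u = x := fun u hu => by
    have h0 := le_max_left 0 (D / 2 - dist y u)
    have h1 : D / 2 ≤ max 0 (D / 2 - dist x u) := by simp only [f] at hu; linarith
    rcases le_max_iff.1 h1 with h | h
    · linarith
    · exact (dist_le_zero.1 (by linarith : dist x u ≤ 0)).symm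
  have heqy : ∀ u, f u ≤ -(D / 2) → u = y := fun u hu => by
    have h0 := le_max_left 0 (D / 2 - dist x u)
    have h1 : D / 2 ≤ max 0 (D / 2 - dist y u) := by simp only [f] at hu; linarith
    rcases le_max_iff.1 h1 with h | h
    · linarith
    · exact (dist_le_zero.1 (by linarith : dist y u ≤ 0)).symm
  have hlip : ∀ u v, |f u - f v| ≤ 2 * dist u v := fun u v => by
    have bump : ∀ z, |max 0 (D / 2 - dist z u) - max 0 (D / 2 - dist z v)| ≤ dist u v :=
      fun z => by
        rw [max_comm 0, max_comm 0]
        refine (abs_max_sub_max_le_abs _ _ _).trans ?_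
        rw [sub_sub_sub_cancel_left, dist_comm z v, dist_comm z u, dist_comm u v]
        exact abs_dist_sub_le _ _ _
    have h1 := abs_le.1 (bump x)
    have h2 := abs_le.1 (bump y)
    simp only [f]
    exact abs_le.2 ⟨by linarith, by linarith⟩
  have hfxy : |f x - f y| = D := by
    rw [hfx, hfy, sub_neg_eq_add, add_halves, abs_of_pos hD]
  refine ⟨fun u v => k / 4 * |f u - f v|, ?_, hxy, fun u v => ?_, fun u v huv h => ?_⟩
  · refine mem_LPMlt hZ ((isPseudometric_abs_sub f).smul (by linarith)) (c := k / 2)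
      (by linarith) (by linarith) fun u v => ?_
    nlinarith [hlip u v]
  · simp only [hfxy]
    refine mul_le_mul_of_nonneg_left (abs_le.2 ⟨?_, ?_⟩) (by linarith)
    · linarith [hle v, hge u]
    · linarith [hle u, hge v]
  · have h1 : D ≤ |f u - f v| := by
      have := h x y
      simp only [hfxy] at this
      exact le_of_mul_le_mul_left this (by linarith)
    rcases le_abs.1 h1 with h2 | h2
    · exact Or.inl ⟨heqx u (by linarith [hge v]), heqy v (by linarith [hle u])⟩
    · exact Or.inr ⟨heqy u (by linarith [hle v]), heqx v (by linarith [hge u])⟩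

theorem exists_separating (hk : 0 < k) (hZ : ∃ C : ℝ, ∀ a b : Z, dist a b ≤ C) {F : Set Z}
    (hF : F.Finite) {a : Z} (ha : a ∉ F) :
    ∃ d ∈ LPMlt k Z, (∀ u ∈ F, ∀ v ∈ F, d u v = 0) ∧ ∀ u ∈ F, 0 < d a u := by
  refine ⟨fun u v => k / 2 * |Metric.infDist u F - Metric.infDist v F|, ?_, ?_, ?_⟩
  · refine mem_LPMlt hZ ((isPseudometric_abs_sub _).smul (by linarith)) (c := k / 2)
      (by linarith) (by linarith) fun u v => mul_le_mul_of_nonneg_left ?_ (by linarith)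
    have h1 := Metric.infDist_le_infDist_add_dist (s := F) (x := u) (y := v)
    have h2 := Metric.infDist_le_infDist_add_dist (s := F) (x := v) (y := u)
    rw [dist_comm v u] at h2
    exact abs_le.2 ⟨by linarith, by linarith⟩
  · intro u hu v hv
    simp [Metric.infDist_zero_of_mem hu, Metric.infDist_zero_of_mem hv]
  · intro u hu
    have h := (hF.isClosed.notMem_iff_infDist_pos ⟨u, hu⟩).1 ha
    simp only [Metric.infDist_zero_of_mem hu, sub_zero, abs_of_pos h]
    positivity

end Constructions

section PeakIsometry

variable {X Y : Type*} [MetricSpace X] [MetricSpace Y] {k : ℝ}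
  {T : (X → X → ℝ) → Y → Y → ℝ} {S : (Y → Y → ℝ) → X → X → ℝ}

/-- `T` and `S` are mutually inverse isometries between `LPMlt k X` and `LPMlt k Y` which
preserve the existence of a strict peak. -/
structure IsPeakIsometry (k : ℝ) (T : (X → X → ℝ) → Y → Y → ℝ)
    (S : (Y → Y → ℝ) → X → X → ℝ) : Prop where
  pos : 0 < k
  bounded : ∃ C : ℝ, ∀ a b : X, dist a b ≤ C
  bounded' : ∃ C : ℝ, ∀ a b : Y, dist a b ≤ C
  map_mem : ∀ d ∈ LPMlt k X, T d ∈ LPMlt k Y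
  inv_mem : ∀ e ∈ LPMlt k Y, S e ∈ LPMlt k X
  left_inv : ∀ d ∈ LPMlt k X, S (T d) = d
  right_inv : ∀ e ∈ LPMlt k Y, T (S e) = e
  abs_sub_le_iff : ∀ d ∈ LPMlt k X, ∀ e ∈ LPMlt k X, ∀ c,
    (∀ u v, |T d u v - T e u v| ≤ c) ↔ ∀ u v, |d u v - e u v| ≤ c
  exists_peak_iff : ∀ d ∈ LPMlt k X,
    (∃ x y, IsStrictPeak d x y) ↔ ∃ x y, IsStrictPeak (T d) x y

/-- The pairs `(x, x')` and `(y, y')` correspond to each other under `T`. -/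
def PeaksCorrespond (k : ℝ) (T : (X → X → ℝ) → Y → Y → ℝ) (x x' : X) (y y' : Y) : Prop :=
  ∀ d ∈ LPMlt k X, IsPeak d x x' ↔ IsPeak (T d) y y'

namespace IsPeakIsometry

theorem symm (hT : IsPeakIsometry k T S) : IsPeakIsometry k S T where
  pos := hT.pos
  bounded := hT.bounded'
  bounded' := hT.bounded
  map_mem := hT.inv_mem
  inv_mem := hT.map_mem
  left_inv := hT.right_inv
  right_inv := hT.left_inv
  abs_sub_le_iff d hd e he c := by
    rw [← hT.abs_sub_le_iff _ (hT.inv_mem d hd) _ (hT.inv_mem e he), hT.right_inv d hd,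
      hT.right_inv e he]
  exists_peak_iff d hd := by
    rw [hT.exists_peak_iff _ (hT.inv_mem d hd), hT.right_inv d hd]

theorem zero_mem (hT : IsPeakIsometry k T S) : (fun _ _ => 0) ∈ LPMlt k X :=
  mem_LPMlt hT.bounded ⟨by simp, by simp, by simp⟩ le_rfl hT.pos (by simp)

theorem map_zero [Nonempty Y] (hT : IsPeakIsometry k T S) (u v : Y) :
    T (fun _ _ => 0) u v = 0 := by
  have h0 := hT.zero_mem
  have he := hT.map_mem _ h0
  set e := T fun _ _ => 0 with he_def
  obtain ⟨c, hc, hck, hec⟩ := exists_lipschitz_of_mem_LPMlt he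
  obtain ⟨t, ht0, ht1, htk⟩ : ∃ t : ℝ, 0 < t ∧ t < 1 ∧ (1 + t) * c < k := by
    refine ⟨min (1 / 2) ((k - c) / (2 * (c + 1))), ?_, ?_, ?_⟩
    · exact lt_min (by norm_num) (div_pos (by linarith) (by linarith))
    · exact (min_le_left _ _).trans_lt (by norm_num)
    · have h1 : min (1 / 2) ((k - c) / (2 * (c + 1))) * (2 * (c + 1)) ≤ k - c := by
        rw [← le_div_iff₀ (by linarith)]
        exact min_le_right _ _
      have h2 : 0 < min (1 / 2) ((k - c) / (2 * (c + 1))) :=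
        lt_min (by norm_num) (div_pos (by linarith) (by linarith))
      nlinarith
  have hp : (fun u v => (1 + t) * e u v) ∈ LPMlt k Y :=
    mem_LPMlt hT.bounded' (he.1.1.smul (by linarith)) (by positivity) htk fun u v => by
      nlinarith [hec u v]
  have hm : (fun u v => (1 - t) * e u v) ∈ LPMlt k Y :=
    smul_mem_LPMlt hT.bounded' he (by linarith) (by linarith)
  have hle := le_supNorm he.1.2.1
  set M := supNorm e
  have hSe : S e = fun _ _ => 0 := by rw [he_def, hT.left_inv _ h0]
  have hSp := (hT.symm.abs_sub_le_iff _ hp _ he (t * M)).2 fun u v => by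
    rw [show (1 + t) * e u v - e u v = t * e u v by ring,
      abs_of_nonneg (mul_nonneg ht0.le (he.1.1.nonneg u v))]
    exact mul_le_mul_of_nonneg_left (hle u v) ht0.le
  have hSm := (hT.symm.abs_sub_le_iff _ hm _ he (t * M)).2 fun u v => by
    rw [show (1 - t) * e u v - e u v = -(t * e u v) by ring, abs_neg,
      abs_of_nonneg (mul_nonneg ht0.le (he.1.1.nonneg u v))]
    exact mul_le_mul_of_nonneg_left (hle u v) ht0.le
  have hpm := (hT.symm.abs_sub_le_iff _ hp _ hm (t * M)).1 fun u v => by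
    have h1 := hSp u v
    have h2 := hSm u v
    have h3 := (hT.inv_mem _ hp).1.1.nonneg u v
    have h4 := (hT.inv_mem _ hm).1.1.nonneg u v
    rw [hSe, sub_zero, abs_of_nonneg h3] at h1
    rw [hSe, sub_zero, abs_of_nonneg h4] at h2
    exact abs_le.2 ⟨by linarith, by linarith⟩
  have hhalf : M ≤ M / 2 := supNorm_le fun u v => by
    have h1 := (abs_le.1 (hpm u v)).2
    have h2 : t * (2 * e u v) ≤ t * M := by linarith
    linarith [le_of_mul_le_mul_left h2 ht0]
  exact le_antisymm (by linarith [hle u v]) (he.1.1.nonneg u v)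

theorem le_iff [Nonempty Y] (hT : IsPeakIsometry k T S) {d : X → X → ℝ} (hd : d ∈ LPMlt k X)
    (c : ℝ) : (∀ u v, T d u v ≤ c) ↔ ∀ u v, d u v ≤ c := by
  have h := hT.abs_sub_le_iff d hd _ hT.zero_mem c
  simp only [hT.map_zero, sub_zero] at h
  have h1 : ∀ u v, |T d u v| = T d u v := fun u v =>
    abs_of_nonneg ((hT.map_mem d hd).1.1.nonneg u v)
  have h2 : ∀ u v, |d u v| = d u v := fun u v => abs_of_nonneg (hd.1.1.nonneg u v)
  simpa only [h1, h2] using h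

/-- If `d` lies metrically between `0` and `d'`, then `T d` peaks wherever `T d'` does. -/
theorem isPeak_of_between [Nonempty Y] (hT : IsPeakIsometry k T S) {d d' : X → X → ℝ}
    (hd : d ∈ LPMlt k X) (hd' : d' ∈ LPMlt k X) {A B : ℝ} {x x' : X} {y y' : Y}
    (hA : ∀ u v, |d' u v - d u v| ≤ A) (hB : ∀ u v, d u v ≤ B) (hAB : A + B ≤ d' x x')
    (hy : IsPeak (T d') y y') : IsPeak (T d) y y' := by
  have h1 := (hT.le_iff hd' _).1 hy x x'
  have h2 := (abs_le.1 ((hT.abs_sub_le_iff _ hd' _ hd A).2 hA y y')).2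
  intro u v
  have h3 := (hT.le_iff hd B).2 hB u v
  linarith

theorem exists_isPeak_map [Nonempty Y] (hT : IsPeakIsometry k T S) {x x' : X} (hx : x ≠ x') :
    ∃ y y' : Y, y ≠ y' ∧ ∀ d ∈ LPMlt k X, IsPeak d x x' → IsPeak (T d) y y' := by
  obtain ⟨g, hg, hgs⟩ := exists_isStrictPeak hT.pos hT.bounded hx
  obtain ⟨y, y', hys⟩ := (hT.exists_peak_iff g hg).1 ⟨x, x', hgs⟩
  refine ⟨y, y', hys.1, fun d hd hdp => ?_⟩
  have key : ∀ s : ℝ, 0 < s → s < 1 → ∀ u v, T d u v ≤ T d y y' + s * (2 * (g x x' + d x x')) := by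
    intro s hs0 hs1
    have hsg := smul_mem_LPMlt hT.bounded hg hs0.le hs1.le
    have hsd := smul_mem_LPMlt hT.bounded hd (s := 1 - s) (by linarith) (by linarith)
    have he : (fun u v => (1 - s) * d u v + s * g u v) ∈ LPMlt k X := by
      obtain ⟨c, hc, hck, hdc⟩ := exists_lipschitz_of_mem_LPMlt hd
      obtain ⟨b, hb, hbk, hgb⟩ := exists_lipschitz_of_mem_LPMlt hg
      refine mem_LPMlt hT.bounded (hsd.1.1.add hsg.1.1) (c := max c b) (le_max_of_le_left hc)
        (max_lt hck hbk) fun u v => ?_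
      have h1 := (hdc u v).trans (mul_le_mul_of_nonneg_right (le_max_left c b) dist_nonneg)
      have h2 := (hgb u v).trans (mul_le_mul_of_nonneg_right (le_max_right c b) dist_nonneg)
      nlinarith
    have hsgs : IsStrictPeak (fun u v => s * g u v) x x' :=
      ⟨hx, fun u v => mul_le_mul_of_nonneg_left (hgs.2.1 u v) hs0.le, fun u v huv h =>
        hgs.2.2 u v huv fun a b => le_of_mul_le_mul_left (h a b) hs0⟩
    have hes : IsStrictPeak (fun u v => (1 - s) * d u v + s * g u v) x x' := by
      refine ⟨hx, fun u v => ?_, fun u v huv h => hgs.2.2 u v huv fun a b => ?_⟩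
      · nlinarith [hgs.2.1 u v, hdp u v]
      · have h1 := h x x'
        have h2 := hdp u v
        have h3 := hgs.2.1 a b
        have h4 : s * g x x' ≤ s * g u v := by nlinarith
        exact h3.trans (le_of_mul_le_mul_left h4 hs0)
    obtain ⟨z, z', hz⟩ := (hT.exists_peak_iff _ hsg).1 ⟨x, x', hsgs⟩
    obtain ⟨w, w', hw⟩ := (hT.exists_peak_iff _ he).1 ⟨x, x', hes⟩
    have hzy := hz.2.2 y y' hys.1 <| hT.isPeak_of_between hsg hg (x := x) (x' := x')
      (A := (1 - s) * g x x') (B := s * g x x') (fun u v => by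
        rw [show g u v - s * g u v = (1 - s) * g u v by ring,
          abs_of_nonneg (mul_nonneg (by linarith) (hg.1.1.nonneg u v))]
        exact mul_le_mul_of_nonneg_left (hgs.2.1 u v) (by linarith))
      (fun u v => hsgs.2.1 u v) (by linarith) hys.2.1
    have hzw := hz.2.2 w w' hw.1 <| hT.isPeak_of_between hsg he (x := x) (x' := x')
      (A := (1 - s) * d x x') (B := s * g x x') (fun u v => by
        rw [add_sub_cancel_right,
          abs_of_nonneg (mul_nonneg (by linarith) (hd.1.1.nonneg u v))]
        exact mul_le_mul_of_nonneg_left (hdp u v) (by linarith))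
      (fun u v => hsgs.2.1 u v) le_rfl hw.2.1
    have hwy : IsPeak (T fun u v => (1 - s) * d u v + s * g u v) y y' := by
      have h1 := hw.2.1
      have h2 := h1.swap (hT.map_mem _ he).1.1
      rcases hzy with ⟨rfl, rfl⟩ | ⟨rfl, rfl⟩ <;> rcases hzw with ⟨rfl, rfl⟩ | ⟨rfl, rfl⟩ <;>
        assumption
    have hclose := (hT.abs_sub_le_iff _ he _ hd (s * (g x x' + d x x'))).2 fun u v => by
      have h1 := hgs.2.1 u v
      have h2 := hdp u v
      have h3 := hg.1.1.nonneg u v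
      have h4 := hd.1.1.nonneg u v
      rw [show (1 - s) * d u v + s * g u v - d u v = s * (g u v - d u v) by ring, abs_mul,
        abs_of_pos hs0]
      exact mul_le_mul_of_nonneg_left (abs_le.2 ⟨by linarith, by linarith⟩) hs0.le
    intro u v
    have h1 := abs_le.1 (hclose u v)
    have h2 := abs_le.1 (hclose y y')
    have h3 := hwy u v
    linarith [h1.1, h2.2]
  intro u v
  have hM : 0 ≤ 2 * (g x x' + d x x') := by
    linarith [hg.1.1.nonneg x x', hd.1.1.nonneg x x']
  refine le_of_forall_pos_le_add fun ε hε => ?_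
  set M := 2 * (g x x' + d x x')
  have hs : 0 < min (1 / 2) (ε / (M + 1)) := lt_min (by norm_num) (by positivity)
  have h := key _ hs ((min_le_left _ _).trans_lt (by norm_num)) u v
  have h2 : min (1 / 2) (ε / (M + 1)) * (M + 1) ≤ ε := by
    rw [← le_div_iff₀ (by linarith)]
    exact min_le_right _ _
  linarith

theorem exists_peaksCorrespond [Nonempty X] [Nonempty Y] (hT : IsPeakIsometry k T S) {y y' : Y}
    (hy : y ≠ y') : ∃ x x' : X, x ≠ x' ∧ PeaksCorrespond k T x x' y y' := by
  obtain ⟨x, x', hx, hxp⟩ := hT.symm.exists_isPeak_map hy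
  obtain ⟨z, z', hz, hzp⟩ := hT.exists_isPeak_map hx
  refine ⟨x, x', hx, fun d hd => ⟨fun h => ?_, fun h => ?_⟩⟩
  · obtain ⟨g, hg, hgs⟩ := exists_isStrictPeak hT.pos hT.bounded' hy
    have h1 := hzp _ (hT.inv_mem g hg) (hxp g hg hgs.2.1)
    rw [hT.right_inv g hg] at h1
    have h2 := hzp d hd h
    rcases hgs.2.2 z z' hz h1 with ⟨rfl, rfl⟩ | ⟨rfl, rfl⟩
    · exact h2
    · exact h2.swap (hT.map_mem d hd).1.1
  · have h1 := hxp _ (hT.map_mem d hd) h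
    rwa [hT.left_inv d hd] at h1

theorem peaksCorrespond_symm (hT : IsPeakIsometry k T S) {x x' : X} {y y' : Y}
    (h : PeaksCorrespond k T x x' y y') : PeaksCorrespond k S y y' x x' := fun e he => by
  rw [h _ (hT.inv_mem e he), hT.right_inv e he]

theorem map_eq_of_isPeak [Nonempty Y] (hT : IsPeakIsometry k T S) {x x' : X} {y y' : Y}
    (h : PeaksCorrespond k T x x' y y') {d : X → X → ℝ} (hd : d ∈ LPMlt k X)
    (hp : IsPeak d x x') : T d y y' = d x x' :=
  le_antisymm ((hT.le_iff hd _).2 hp y y') ((hT.le_iff hd _).1 ((h d hd).1 hp) x x')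

section Step

variable {x x' : X} {y y' : Y} {R h : ℝ} {d : X → X → ℝ}

theorem map_eq_of_le_max [Nonempty Y] (hT : IsPeakIsometry k T S)
    (hc : PeaksCorrespond k T x x' y y')
    (hR : ∀ e ∈ LPMlt k X, (∀ u v, e u v ≤ R) → T e y y' = e x x') (hd : d ∈ LPMlt k X)
    (hle : ∀ u v, d u v ≤ max R (d x x')) : T d y y' = d x x' := by
  rcases le_total (d x x') R with h | h
  · exact hR d hd fun u v => (hle u v).trans (max_le le_rfl h)
  · exact hT.map_eq_of_isPeak hc hd fun u v => (hle u v).trans (max_le h le_rfl)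

theorem le_map_of_add_lt [Nonempty Y] (hT : IsPeakIsometry k T S) (hx : x ≠ x')
    (hc : PeaksCorrespond k T x x' y y')
    (hR : ∀ e ∈ LPMlt k X, (∀ u v, e u v ≤ R) → T e y y' = e x x') (hh : 0 ≤ h)
    (hd : d ∈ LPMlt k X) (hdR : ∀ u v, d u v ≤ R + h) (hlt : d x x' + h < k * dist x x') :
    d x x' ≤ T d y y' := by
  have hps := hd.1.1
  have hb := hps.nonneg x x'
  have hD := dist_pos.2 hx
  obtain ⟨c₀, hc₀, hck₀, hdc₀⟩ := exists_lipschitz_of_mem_LPMlt hd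
  obtain ⟨c, hc0, hck, hdc, hcx⟩ : ∃ c, 0 ≤ c ∧ c < k ∧ (∀ u v, d u v ≤ c * dist u v) ∧
      d x x' + h ≤ c * dist x x' := by
    refine ⟨max c₀ ((d x x' + h) / dist x x'), le_max_of_le_left hc₀,
      max_lt hck₀ ((div_lt_iff₀ hD).2 hlt), fun u v => (hdc₀ u v).trans ?_, ?_⟩
    · exact mul_le_mul_of_nonneg_right (le_max_left _ _) dist_nonneg
    · rw [← div_le_iff₀ hD]
      exact le_max_right _ _
  let G : X → ℝ := fun u => max (d x u) (d x x' + h - c * dist x' u)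
  have hGx : G x = 0 := by
    simp only [G, hps.1 x]
    exact max_eq_left (by rw [dist_comm]; linarith)
  have hGx' : G x' = d x x' + h := by
    simp only [G, dist_self]
    rw [max_eq_right (by linarith)]
    ring
  have hGge : ∀ u, d x u ≤ G u := fun u => le_max_left _ _
  have hGle : ∀ u, G u ≤ d x u + h := fun u => by
    refine max_le (by linarith) ?_
    have h1 := hps.2.2 x u x'
    have h2 := hdc u x'
    rw [dist_comm] at h2
    linarith
  have hGlip : ∀ u v, G u - G v ≤ c * dist u v := fun u v => by
    have h1 : d x u ≤ d x v + c * dist u v := by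
      have := hps.2.2 x v u
      have := hdc v u
      rw [dist_comm] at this
      linarith
    have h2 : c * dist x' v ≤ c * (dist x' u + dist u v) :=
      mul_le_mul_of_nonneg_left (dist_triangle _ _ _) hc0
    have h3 := le_max_left (d x v) (d x x' + h - c * dist x' v)
    have h4 := le_max_right (d x v) (d x x' + h - c * dist x' v)
    have h5 : G u ≤ G v + c * dist u v := max_le (by simp only [G]; linarith)
      (by simp only [G]; linarith)
    linarith
  have he : (fun u v => min (max (d u v) |G u - G v|) (max R (d x x' + h))) ∈ LPMlt k X := by
    refine mem_LPMlt hT.bounded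
      ((hps.max (isPseudometric_abs_sub G)).min_const (le_max_of_le_right (by linarith))) hc0 hck
      fun u v => (min_le_left _ _).trans (max_le (hdc u v) (abs_le.2 ⟨?_, hGlip u v⟩))
    have := hGlip v u
    rw [dist_comm] at this
    linarith
  have hex : min (max (d x x') |G x - G x'|) (max R (d x x' + h)) = d x x' + h := by
    rw [hGx, hGx', zero_sub, abs_neg, abs_of_nonneg (by linarith), max_eq_right (by linarith)]
    exact min_eq_left (le_max_right _ _)
  have hmap := hT.map_eq_of_le_max hc hR he fun u v => by
    simp only [hex]
    exact min_le_right _ _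
  simp only [hex] at hmap
  have hclose := (hT.abs_sub_le_iff _ he _ hd h).2 fun u v => by
    have h1 := hdR u v
    have h2 : |G u - G v| ≤ d u v + h := by
      have h3 := hps.2.2 x u v
      have h4 := hps.2.2 x v u
      rw [hps.2.1 v u] at h4
      exact abs_le.2 ⟨by linarith [hGge u, hGle v], by linarith [hGge v, hGle u]⟩
    have h5 : d u v - h ≤ min (max (d u v) |G u - G v|) (max R (d x x' + h)) :=
      le_min ((by linarith : d u v - h ≤ d u v).trans (le_max_left _ _))
        ((by linarith : d u v - h ≤ R).trans (le_max_left _ _))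
    have h6 : min (max (d u v) |G u - G v|) (max R (d x x' + h)) ≤ d u v + h :=
      (min_le_left _ _).trans (max_le (by linarith) h2)
    exact abs_le.2 ⟨by linarith, by linarith⟩
  have := (abs_le.1 (hclose y y')).2
  linarith

theorem map_le_of_le (hT : IsPeakIsometry k T S)
    (hR : ∀ e ∈ LPMlt k X, (∀ u v, e u v ≤ R) → T e y y' = e x x') (hR0 : 0 ≤ R) (hh : 0 ≤ h)
    (hd : d ∈ LPMlt k X) (hdR : ∀ u v, d u v ≤ R + h) (hle : h ≤ d x x') :
    T d y y' ≤ d x x' := by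
  have hps := hd.1.1
  have hsc := hps.shortcut x x' (c := d x x' - h) (by linarith)
  have he : (fun u v => min (shortcut d x x' (d x x' - h) u v) R) ∈ LPMlt k X :=
    mem_LPMlt_of_le hT.bounded hd (hsc.min_const hR0) fun u v =>
      (min_le_left _ _).trans (min_le_left _ _)
  have hex : min (shortcut d x x' (d x x' - h) x x') R ≤ d x x' - h := by
    refine (min_le_left _ _).trans ((min_le_right _ _).trans ((min_le_left _ _).trans ?_))
    simp [hps.1]
  have hmap := hR _ he fun u v => min_le_right _ _
  have hclose := (hT.abs_sub_le_iff _ hd _ he h).2 fun u v => by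
    have h1 := hps.2.2 u x v
    have h2 := hps.2.2 x x' v
    have h3 := hps.2.2 u x' v
    have h4 := hps.2.2 x' x v
    rw [hps.2.1 x' x] at h4
    have h5 : d u v - h ≤ min (shortcut d x x' (d x x' - h) u v) R :=
      le_min (le_min (by linarith) (le_min (by linarith) (by linarith)))
        (by linarith [hdR u v])
    have h6 : min (shortcut d x x' (d x x' - h) u v) R ≤ d u v :=
      (min_le_left _ _).trans (min_le_left _ _)
    exact abs_le.2 ⟨by linarith, by linarith⟩
  have := (abs_le.1 (hclose y y')).2
  linarith

theorem abs_map_sub_le [Nonempty Y] (hT : IsPeakIsometry k T S)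
    (hc : PeaksCorrespond k T x x' y y')
    (hR : ∀ e ∈ LPMlt k X, (∀ u v, e u v ≤ R) → T e y y' = e x x') (hR0 : 0 ≤ R) (hh : 0 ≤ h)
    (hd : d ∈ LPMlt k X) (hdR : ∀ u v, d u v ≤ R + h) : |d x x' - T d y y'| ≤ h := by
  have hps := hd.1.1
  have he : (fun u v => min (d u v) (max R (d x x'))) ∈ LPMlt k X :=
    mem_LPMlt_of_le hT.bounded hd (hps.min_const (le_max_of_le_left hR0))
      fun u v => min_le_left _ _
  have hex : min (d x x') (max R (d x x')) = d x x' := min_eq_left (le_max_right _ _)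
  have hmap := hT.map_eq_of_le_max hc hR he fun u v => by
    simp only [hex]
    exact min_le_right _ _
  simp only [hex] at hmap
  rw [← hmap]
  refine (hT.abs_sub_le_iff _ he _ hd h).2 (fun u v => ?_) y y'
  have h1 : d u v - h ≤ min (d u v) (max R (d x x')) :=
    le_min (by linarith) (le_max_of_le_left (by linarith [hdR u v]))
  have h2 : min (d u v) (max R (d x x')) ≤ d u v := min_le_left _ _
  exact abs_le.2 ⟨by linarith, by linarith⟩

end Step

theorem map_eq [Nonempty X] [Nonempty Y] (hT : IsPeakIsometry k T S) {x x' : X} {y y' : Y}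
    (hx : x ≠ x') (hy : y ≠ y') (hc : PeaksCorrespond k T x x' y y') :
    ∀ d ∈ LPMlt k X, T d y y' = d x x' := by
  have hk := hT.pos
  obtain ⟨h, hh, hhx, hhy⟩ : ∃ h : ℝ, 0 < h ∧ 4 * h ≤ k * dist x x' ∧ 4 * h ≤ k * dist y y' := by
    have h1 := mul_pos hk (dist_pos.2 hx)
    have h2 := mul_pos hk (dist_pos.2 hy)
    refine ⟨min (k * dist x x') (k * dist y y') / 4, by positivity, ?_, ?_⟩
    · linarith [min_le_left (k * dist x x') (k * dist y y')]
    · linarith [min_le_right (k * dist x x') (k * dist y y')]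
  have key : ∀ n : ℕ, ∀ d ∈ LPMlt k X, (∀ u v, d u v ≤ n * h) → T d y y' = d x x' := by
    intro n
    induction n with
    | zero =>
      intro d hd hd0
      simp only [Nat.cast_zero, zero_mul] at hd0
      have h1 := (hT.le_iff hd 0).2 hd0 y y'
      have h2 := (hT.map_mem d hd).1.1.nonneg y y'
      linarith [hd0 x x', hd.1.1.nonneg x x']
    | succ n ih =>
      intro d hd hdn
      have hR0 : 0 ≤ n * h := by positivity
      have hdR : ∀ u v, d u v ≤ n * h + h := fun u v => by
        have := hdn u v
        push_cast at this
        linarith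
      have ih' : ∀ e ∈ LPMlt k Y, (∀ u v, e u v ≤ n * h) → S e x x' = e y y' := by
        intro e he hen
        have := ih _ (hT.inv_mem e he) ((hT.symm.le_iff he _).2 hen)
        rw [hT.right_inv e he] at this
        exact this.symm
      have hTd := hT.map_mem d hd
      have hTdR := (hT.le_iff hd _).2 hdR
      have hc' := hT.peaksCorrespond_symm hc
      have hnear := abs_le.1 (hT.abs_map_sub_le hc ih hR0 hh.le hd hdR)
      rcases lt_or_ge (d x x') (2 * h) with hb | hb
      · have h1 := hT.le_map_of_add_lt hx hc ih hh.le hd hdR (by linarith)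
        have h2 := hT.symm.le_map_of_add_lt hy hc' ih' hh.le hTd hTdR (by linarith)
        rw [hT.left_inv d hd] at h2
        exact le_antisymm h2 h1
      · have h1 := hT.map_le_of_le ih hR0 hh.le hd hdR (by linarith)
        have h2 := hT.symm.map_le_of_le ih' hR0 hh.le hTd hTdR (by linarith)
        rw [hT.left_inv d hd] at h2
        exact le_antisymm h1 h2
  intro d hd
  obtain ⟨C, hC⟩ := hd.1.2.1
  obtain ⟨n, hn⟩ := exists_nat_ge (C / h)
  exact key n d hd fun u v => (hC u v).trans ((div_le_iff₀ hh).1 hn)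

theorem exists_map_eq [Nonempty X] [Nonempty Y] (hT : IsPeakIsometry k T S) {y y' : Y}
    (hy : y ≠ y') : ∃ x x' : X, x ≠ x' ∧ ∀ d ∈ LPMlt k X, T d y y' = d x x' := by
  obtain ⟨x, x', hx, hc⟩ := hT.exists_peaksCorrespond hy
  exact ⟨x, x', hx, hT.map_eq hx hy hc⟩

theorem dist_le_of_map_eq (hT : IsPeakIsometry k T S) {x x' : X} {y y' : Y} (hy : y ≠ y')
    (h : ∀ d ∈ LPMlt k X, T d y y' = d x x') : dist x x' ≤ dist y y' := by
  refine le_of_forall_lt_imp_le_of_dense fun a ha => ?_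
  by_contra! hcon
  have hk := hT.pos
  have hD : 0 < dist x x' := dist_nonneg.trans_lt (hcon.trans ha)
  have ha0 : 0 < a := dist_nonneg.trans_lt hcon
  have hs : k * (a / dist x x') < k := by
    have := (div_lt_one hD).2 ha
    nlinarith
  have hd : (fun u v : X => k * (a / dist x x') * dist u v) ∈ LPMlt k X :=
    mem_LPMlt hT.bounded (IsPseudometric.smul ⟨dist_self, dist_comm, dist_triangle⟩
      (by positivity)) (by positivity) hs fun u v => le_rfl
  have h1 := lt_of_mem_LPMlt (hT.map_mem _ hd) hy
  rw [h _ hd, mul_assoc, div_mul_cancel₀ _ hD.ne'] at h1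
  exact absurd (lt_of_mul_lt_mul_left h1 hk.le) (not_lt.2 hcon.le)

end IsPeakIsometry

end PeakIsometry

section Reconstruction

/-- A map from pairs to pairs which sends triangles to triangles and separates points is
induced by a map of points. -/
theorem exists_map_of_pairs {X Y : Type*} [Nontrivial Y] (P : Y → Y → Set X)
    (hpair : ∀ y y', y ≠ y' → ∃ a b, P y y' = {a, b}) (hsymm : ∀ y y', P y y' = P y' y)
    (htri : ∀ y₁ y₂ y₃, y₁ ≠ y₂ → y₁ ≠ y₃ → y₂ ≠ y₃ → ∃ a b c, a ≠ b ∧ a ≠ c ∧ b ≠ c ∧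
      P y₁ y₂ = {a, b} ∧ P y₁ y₃ = {a, c} ∧ P y₂ y₃ = {b, c})
    (hinj : ∀ y z w w', y ≠ z → w ≠ w' → P y z = P w w' → y = w ∨ y = w') :
    ∃ φ : Y → X, ∀ y y', y ≠ y' → P y y' = {φ y, φ y'} := by
  classical
  by_cases h3 : ∀ y y' : Y, y ≠ y' → ∃ z, y ≠ z ∧ y' ≠ z
  · have hcommon : ∀ y, ∃ a, ∀ z, y ≠ z → a ∈ P y z := by
      intro y
      obtain ⟨z, hz⟩ := exists_ne y
      obtain ⟨w, hyw, hzw⟩ := h3 y z hz.symm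
      obtain ⟨a, b, c, hab, hac, hbc, hyz', hyw', hzw'⟩ := htri y z w hz.symm hyw hzw
      refine ⟨a, fun v hv => ?_⟩
      by_cases hvz : z = v
      · subst hvz; simp [hyz']
      by_cases hvw : w = v
      · subst hvw; simp [hyw']
      obtain ⟨a₁, b₁, c₁, -, -, -, h1, h2, -⟩ := htri y z v hz.symm hv hvz
      obtain ⟨a₂, b₂, c₂, -, hac₂, -, h3, h4, -⟩ := htri y w v hyw hv hvw
      by_contra hmem
      have hb : b ∈ P y v := by
        have hm : a₁ ∈ P y z := by simp [h1]
        have hm' : a₁ ∈ P y v := by simp [h2]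
        rw [hyz'] at hm
        rcases hm with rfl | rfl
        · exact absurd hm' hmem
        · exact hm'
      have hc : c ∈ P y v := by
        have hm : a₂ ∈ P y w := by simp [h3]
        have hm' : a₂ ∈ P y v := by simp [h4]
        rw [hyw'] at hm
        rcases hm with rfl | rfl
        · exact absurd hm' hmem
        · exact hm'
      have heq : P y v = P z w := by
        rw [hzw']
        rw [h4] at hb hc ⊢
        simp only [mem_insert_iff, mem_singleton_iff] at hb hc
        rcases hb with rfl | rfl <;> rcases hc with rfl | rfl
        · exact absurd rfl hbc
        · rfl
        · exact pair_comm _ _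
        · exact absurd rfl hbc
      rcases hinj y v z w hv hzw heq with h | h
      · exact hz h.symm
      · exact hyw h
    choose φ hφ using hcommon
    refine ⟨φ, fun y y' hy => ?_⟩
    obtain ⟨z, hyz, hyz'⟩ := h3 y y' hy
    obtain ⟨a, b, c, hab, hac, hbc, h1, h2, h3⟩ := htri y y' z hy hyz hyz'
    have m1 := hφ y y' hy
    have m2 := hφ y z hyz
    have m3 := hφ y' y hy.symm
    have m4 := hφ y' z hyz'
    rw [hsymm] at m3
    rw [h1] at m1 m3
    rw [h2] at m2
    rw [h3] at m4
    simp only [mem_insert_iff, mem_singleton_iff] at m1 m2 m3 m4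
    have ha : φ y = a := by
      rcases m1 with h | h
      · exact h
      · rcases m2 with h' | h'
        · exact h'
        · exact absurd (h.symm.trans h') hbc
    have hb : φ y' = b := by
      rcases m3 with h | h
      · rcases m4 with h' | h'
        · exact h'
        · exact absurd (h.symm.trans h') hac
      · exact h
    rw [ha, hb, h1]
  · push Not at h3
    obtain ⟨y₀, y₁, hy, hall⟩ := h3
    obtain ⟨a, b, hab⟩ := hpair y₀ y₁ hy
    refine ⟨fun y => if y = y₀ then a else b, fun y y' hyy => ?_⟩
    have hcases : ∀ z, z = y₀ ∨ z = y₁ := fun z => by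
      by_cases hz : y₀ = z
      · exact Or.inl hz.symm
      · exact Or.inr (hall z hz).symm
    rcases hcases y with rfl | rfl <;> rcases hcases y' with rfl | rfl
    · exact absurd rfl hyy
    · simp [hy.symm, hab]
    · simp [hyy, hsymm y, hab, pair_comm]
    · exact absurd rfl hyy

variable {Z : Type*} [MetricSpace Z] {k : ℝ}

theorem pair_eq_of_forall_eq (hk : 0 < k) (hZ : ∃ C : ℝ, ∀ a b : Z, dist a b ≤ C)
    {x x' z z' : Z} (hx : x ≠ x') (hz : z ≠ z') (h : ∀ d ∈ LPMlt k Z, d x x' = d z z') :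
    ({x, x'} : Set Z) = {z, z'} := by
  obtain ⟨g, hg, hgs⟩ := exists_isStrictPeak hk hZ hz
  refine pair_eq_pair_iff.2 (hgs.2.2 x x' hx fun u v => ?_)
  rw [h g hg]
  exact hgs.2.1 u v

/-- If `d a a' ≤ d b b' + d c c'` for all `d`, then `a` is one of `b`, `b'`, `c`, `c'`. -/
theorem mem_of_forall_le_add (hk : 0 < k) (hZ : ∃ C : ℝ, ∀ a b : Z, dist a b ≤ C)
    {a a' b b' c c' : Z} (ha : a ≠ a') (h : ∀ d ∈ LPMlt k Z, d a a' ≤ d b b' + d c c') :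
    a ∈ ({b, b'} : Set Z) ∪ {c, c'} := by
  by_contra hmem
  simp only [mem_union, mem_insert_iff, mem_singleton_iff, not_or] at hmem
  obtain ⟨⟨h1, h2⟩, h3, h4⟩ := hmem
  obtain ⟨d, hd, h0, hpos⟩ := exists_separating hk hZ (F := {a', b, b', c, c'}) (a := a)
    (by simp) (by simp [ha, h1, h2, h3, h4])
  have := h d hd
  rw [h0 b (by simp) b' (by simp), h0 c (by simp) c' (by simp)] at this
  linarith [hpos a' (by simp)]

theorem pair_triangle {X : Type*} {a a' b b' c c' : X} (ha : a ≠ a') (hb : b ≠ b')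
    (hab : ({a, a'} : Set X) ≠ {b, b'}) (hbc : ({b, b'} : Set X) ≠ {c, c'})
    (hA : ({a, a'} : Set X) ⊆ {b, b'} ∪ {c, c'}) (hB : ({b, b'} : Set X) ⊆ {a, a'} ∪ {c, c'}) :
    ∃ p q r, p ≠ q ∧ p ≠ r ∧ q ≠ r ∧ ({a, a'} : Set X) = {p, q} ∧ ({b, b'} : Set X) = {p, r} ∧
      ({c, c'} : Set X) = {q, r} := by
  classical
  simp only [ne_eq, pair_eq_pair_iff, insert_subset_iff, singleton_subset_iff, mem_union,
    mem_insert_iff, mem_singleton_iff] at *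
  by_cases h : a = b ∨ a = b'
  · refine ⟨a, a', if a = b then b' else b, ?_⟩
    grind
  · refine ⟨a', a, if a' = b then b' else b, ?_⟩
    grind

namespace IsPeakIsometry

variable {X Y : Type*} [MetricSpace X] [MetricSpace Y] {T : (X → X → ℝ) → Y → Y → ℝ}
  {S : (Y → Y → ℝ) → X → X → ℝ}

theorem pair_eq_of_map_eq (hT : IsPeakIsometry k T S) {x x' : X} {y y' z z' : Y}
    (hy : y ≠ y') (hz : z ≠ z') (h : ∀ d ∈ LPMlt k X, T d y y' = d x x')
    (h' : ∀ d ∈ LPMlt k X, T d z z' = d x x') : ({y, y'} : Set Y) = {z, z'} := by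
  refine pair_eq_of_forall_eq hT.pos hT.bounded' hy hz fun e he => ?_
  have h1 := h _ (hT.inv_mem e he)
  have h2 := h' _ (hT.inv_mem e he)
  rw [hT.right_inv e he] at h1 h2
  rw [h1, h2]

theorem exists_equiv [Nontrivial X] [Nontrivial Y] (hT : IsPeakIsometry k T S) :
    ∃ φ : Y ≃ X, ∀ d ∈ LPMlt k X, ∀ y y', T d y y' = d (φ y) (φ y') := by
  have hk := hT.pos
  have hswap : ∀ {x x' z z' : X}, ({x, x'} : Set X) = {z, z'} → ∀ d ∈ LPMlt k X,
      d x x' = d z z' := fun h d hd => by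
    rcases pair_eq_pair_iff.1 h with ⟨rfl, rfl⟩ | ⟨rfl, rfl⟩
    · rfl
    · exact hd.1.1.2.1 _ _
  have hex : ∀ y y' : Y, ∃ p : X × X, y ≠ y' →
      p.1 ≠ p.2 ∧ ∀ d ∈ LPMlt k X, T d y y' = d p.1 p.2 := fun y y' => by
    by_cases hy : y = y'
    · obtain ⟨x⟩ := (inferInstance : Nonempty X)
      exact ⟨(x, x), fun h => absurd hy h⟩
    · obtain ⟨x, x', hx, h⟩ := hT.exists_map_eq hy
      exact ⟨(x, x'), fun _ => ⟨hx, h⟩⟩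
  choose p hp using hex
  let P : Y → Y → Set X := fun y y' => {(p y y').1, (p y y').2}
  have hinj : ∀ y z w w', y ≠ z → w ≠ w' → P y z = P w w' → ({y, z} : Set Y) = {w, w'} := by
    intro y z w w' hy hw h
    refine hT.pair_eq_of_map_eq hy hw (hp y z hy).2 fun d hd => ?_
    rw [(hp w w' hw).2 d hd, hswap h d hd]
  have hsymm : ∀ y y', P y y' = P y' y := fun y y' => by
    by_cases hy : y = y'
    · rw [hy]
    · refine pair_eq_of_forall_eq hk hT.bounded (hp y y' hy).1 (hp y' y (Ne.symm hy)).1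
        fun d hd => ?_
      rw [← (hp y y' hy).2 d hd, ← (hp y' y (Ne.symm hy)).2 d hd]
      exact (hT.map_mem d hd).1.1.2.1 _ _
  have hsub : ∀ y₁ y₂ y₃, y₁ ≠ y₂ → y₁ ≠ y₃ → y₂ ≠ y₃ → P y₁ y₂ ⊆ P y₁ y₃ ∪ P y₂ y₃ := by
    intro y₁ y₂ y₃ h12 h13 h23
    have hle : ∀ d ∈ LPMlt k X, d (p y₁ y₂).1 (p y₁ y₂).2 ≤
        d (p y₁ y₃).1 (p y₁ y₃).2 + d (p y₂ y₃).1 (p y₂ y₃).2 := fun d hd => by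
      rw [← (hp _ _ h12).2 d hd, ← (hp _ _ h13).2 d hd, ← (hp _ _ h23).2 d hd,
        (hT.map_mem d hd).1.1.2.1 y₂ y₃]
      exact (hT.map_mem d hd).1.1.2.2 _ _ _
    refine insert_subset_iff.2 ⟨?_, singleton_subset_iff.2 ?_⟩
    · exact mem_of_forall_le_add hk hT.bounded (hp _ _ h12).1 hle
    · exact mem_of_forall_le_add hk hT.bounded (hp _ _ h12).1.symm fun d hd =>
        (hd.1.1.2.1 _ _).trans_le (hle d hd)
  obtain ⟨φ, hφ⟩ := exists_map_of_pairs P (fun y y' _ => ⟨_, _, rfl⟩) hsymm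
    (fun y₁ y₂ y₃ h12 h13 h23 => by
      have n1 : P y₁ y₂ ≠ P y₁ y₃ := fun h => by
        have := pair_eq_pair_iff.1 (hinj _ _ _ _ h12 h13 h)
        grind
      have n3 : P y₁ y₃ ≠ P y₂ y₃ := fun h => by
        have := pair_eq_pair_iff.1 (hinj _ _ _ _ h13 h23 h)
        grind
      have s1 := hsub _ _ _ h12 h13 h23
      have s2 := hsub _ _ _ h13 h12 h23.symm
      rw [hsymm y₃ y₂] at s2
      exact pair_triangle (hp _ _ h12).1 (hp _ _ h13).1 n1 n3 s1 s2)
    (fun y z w w' hy hw h => by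
      have := pair_eq_pair_iff.1 (hinj y z w w' hy hw h)
      grind)
  have hmap : ∀ d ∈ LPMlt k X, ∀ y y', T d y y' = d (φ y) (φ y') := fun d hd y y' => by
    by_cases hy : y = y'
    · subst hy
      rw [hd.1.1.1, (hT.map_mem d hd).1.1.1]
    · rw [(hp y y' hy).2 d hd]
      exact hswap (hφ y y' hy) d hd
  have hφinj : Function.Injective φ := fun y y' h => by
    by_contra hy
    have h1 := hφ y y' hy
    rw [h] at h1
    have h2 := pair_eq_pair_iff.1 h1
    exact (hp y y' hy).1 (by grind)
  have hφsurj : Function.Surjective φ := fun x => by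
    obtain ⟨x', hx⟩ := exists_ne x
    obtain ⟨y, y', hy, h⟩ := hT.symm.exists_map_eq hx.symm
    have h1 : ({x, x'} : Set X) = {φ y, φ y'} :=
      pair_eq_of_forall_eq hk hT.bounded hx.symm (hφinj.ne hy) fun d hd => by
        rw [← hmap d hd, ← h _ (hT.map_mem d hd), hT.left_inv d hd]
    rcases pair_eq_pair_iff.1 h1 with ⟨h, -⟩ | ⟨h, -⟩
    · exact ⟨y, h.symm⟩
    · exact ⟨y', h.symm⟩
  exact ⟨Equiv.ofBijective φ ⟨hφinj, hφsurj⟩, hmap⟩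

end IsPeakIsometry

theorem isPeakIsometry_invFunOn {X Y : Type*} [MetricSpace X] [MetricSpace Y]
    [Nonempty X] [Nonempty Y]
    (hX : ∃ C : ℝ, ∀ a b : X, dist a b ≤ C) (hY : ∃ C : ℝ, ∀ a b : Y, dist a b ≤ C)
    (hk : 0 < k) {T : (X → X → ℝ) → (Y → Y → ℝ)}
    (hbij : Set.BijOn T (LPMlt k X) (LPMlt k Y))
    (hiso : ∀ d ∈ LPMlt k X, ∀ e ∈ LPMlt k X, supDist (T d) (T e) = supDist d e)
    (hPp : T '' (Pp X ∩ LPMlt k X) = Pp Y ∩ LPMlt k Y) :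
    IsPeakIsometry k T (Function.invFunOn T (LPMlt k X)) where
  pos := hk
  bounded := hX
  bounded' := hY
  map_mem := hbij.mapsTo
  inv_mem _ he := hbij.surjOn.mapsTo_invFunOn he
  left_inv _ hd := hbij.injOn.leftInvOn_invFunOn hd
  right_inv _ he := hbij.surjOn.rightInvOn_invFunOn he
  abs_sub_le_iff d hd e he c := by
    have hTd := hbij.mapsTo hd
    have hTe := hbij.mapsTo he
    rw [← supDist_le_iff hTd.1.1 hTe.1.1 hTd.1.2.1 hTe.1.2.1, hiso d hd e he,
      supDist_le_iff hd.1.1 he.1.1 hd.1.2.1 he.1.2.1]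
  exists_peak_iff d hd := by
    rw [← mem_Pp_iff hd, ← mem_Pp_iff (hbij.mapsTo hd)]
    constructor
    · exact fun h => (hPp.subset (mem_image_of_mem T ⟨h, hd⟩)).1
    · intro h
      obtain ⟨e, ⟨he, he'⟩, heq⟩ := hPp.superset ⟨h, hbij.mapsTo hd⟩
      rwa [← hbij.injOn he' hd heq]

end Reconstruction

theorem stmt7 {X Y : Type*} [MetricSpace X] [MetricSpace Y]
    [Nontrivial X] [Nontrivial Y]
    (hX : ∃ C : ℝ, ∀ a b : X, dist a b ≤ C) (hY : ∃ C : ℝ, ∀ a b : Y, dist a b ≤ C)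
    (k : ℝ) (hk : 0 < k)
    (T : (X → X → ℝ) → (Y → Y → ℝ))
    (hbij : Set.BijOn T (LPMlt k X) (LPMlt k Y))
    (hiso : ∀ d ∈ LPMlt k X, ∀ e ∈ LPMlt k X, supDist (T d) (T e) = supDist d e)
    (hPp : T '' (Pp X ∩ LPMlt k X) = Pp Y ∩ LPMlt k Y) :
    (∃ φ : Y ≃ X, (∀ x y : Y, dist (φ x) (φ y) = dist x y) ∧
      ∀ d ∈ LPMlt k X, ∀ x y : Y, T d x y = d (φ x) (φ y)) ∧
    (¬ ExactlyTwo X → ¬ ExactlyTwo Y →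
      ∀ φ₁ φ₂ : Y ≃ X,
        ((∀ x y : Y, dist (φ₁ x) (φ₁ y) = dist x y) ∧
          ∀ d ∈ LPMlt k X, ∀ x y : Y, T d x y = d (φ₁ x) (φ₁ y)) →
        ((∀ x y : Y, dist (φ₂ x) (φ₂ y) = dist x y) ∧
          ∀ d ∈ LPMlt k X, ∀ x y : Y, T d x y = d (φ₂ x) (φ₂ y)) →
        ∀ y : Y, φ₁ y = φ₂ y) := by
  have hT := isPeakIsometry_invFunOn hX hY hk hbij hiso hPp
  constructor
  · obtain ⟨φ, hφ⟩ := hT.exists_equiv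
    refine ⟨φ, fun x y => ?_, hφ⟩
    by_cases hxy : x = y
    · simp [hxy]
    · refine le_antisymm (hT.dist_le_of_map_eq hxy fun d hd => hφ d hd x y)
        (hT.symm.dist_le_of_map_eq (φ.injective.ne hxy) fun e he => ?_)
      rw [← hφ _ (hT.inv_mem e he), hT.right_inv e he]
  · rintro - hY2 φ₁ φ₂ ⟨-, h₁⟩ ⟨-, h₂⟩ y
    by_contra hne
    have hz : ∀ z, z ≠ y → φ₁ z = φ₂ y := fun z hz => by
      have hpair := pair_eq_of_forall_eq hk hX (φ₁.injective.ne hz) (φ₂.injective.ne hz)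
        fun d hd => by rw [← h₁ d hd, ← h₂ d hd]
      rcases pair_eq_pair_iff.1 hpair with ⟨-, h⟩ | ⟨h, -⟩
      · exact absurd h hne
      · exact h
    obtain ⟨z, hzy⟩ := exists_ne y
    refine hY2 ⟨y, z, hzy.symm, fun c => or_iff_not_imp_left.2 fun hc => ?_⟩
    exact φ₁.injective ((hz c hc).trans (hz z hzy).symm)

end BanachStone
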